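/- Let (T,y) be a labeled weighted tree, let L' be the line graph with duplicates produced by WTA's depth-first linearization of T, and let L be the line graph obtained after duplicate elimination, each node of L' and L inheriting the label of the corresponding node of T. Then: (1) Φ^W_L(y) ≤ Φ^W_{L'}(y) ≤ 2·Φ^W_T(y); and (2) Φ_L(y) ≤ Φ_{L'}(y) ≤ 2·Φ_T(y). -/

import Mathlib

open Classical

noncomputable section

variable {V : Type} [Fintype V] [DecidableEq V]

/-- The predicate on unordered edges saying the two endpoints have different labels
(a φ-edge). -/
def phiPred (y : V → Bool) : Sym2 V → Prop :=
  Sym2.lift ⟨fun i j => y i ≠ y j, fun _ _ => propext ne_comm⟩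

/-- The set of φ-edges of a labeled graph. -/
def phiEdges (G : SimpleGraph V) (y : V → Bool) : Set (Sym2 V) :=
  {e ∈ G.edgeSet | phiPred y e}

/-- The cutsize `Φ_G(y)`: number of φ-edges. -/
def cutN (G : SimpleGraph V) (y : V → Bool) : ℕ := (phiEdges G y).ncard

/-- The weighted cutsize `Φ^W_G(y)`. -/
def cutW (G : SimpleGraph V) (w : Sym2 V → ℝ) (y : V → Bool) : ℝ :=
  ∑ᶠ e ∈ phiEdges G y, w e

/-- The weight of a spanning tree: product of its edge weights. -/
def treeWeight (w : Sym2 V → ℝ) (T : SimpleGraph V) : ℝ :=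
  ∏ᶠ e ∈ T.edgeSet, w e

/-- `T` is a spanning tree of `G`. -/
def IsSpanningTree (G T : SimpleGraph V) : Prop := T ≤ G ∧ T.IsTree

/-- Expectation, over a random spanning tree of `G` drawn with probability proportional to
the product of its edge weights, of a function `f` of the tree. -/
def rstExp (G : SimpleGraph V) (w : Sym2 V → ℝ) (f : SimpleGraph V → ℝ) : ℝ :=
  (∑ᶠ T ∈ {T : SimpleGraph V | IsSpanningTree G T}, treeWeight w T * f T) /
    ∑ᶠ T ∈ {T : SimpleGraph V | IsSpanningTree G T}, treeWeight w T

/-- `R^W_T(¬E')`: sum of resistors of φ-free edges outside `E'`. -/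
def resistorSum (T : SimpleGraph V) (w : Sym2 V → ℝ) (y : V → Bool) (E' : Set (Sym2 V)) : ℝ :=
  ∑ᶠ e ∈ T.edgeSet \ (phiEdges T y ∪ E'), 1 / w e

/-- Effective conductance between `i` and `j` (Dirichlet principle). -/
def effCond (w : Sym2 V → ℝ) (i j : V) : ℝ :=
  sInf {x | ∃ φ : V → ℝ, φ i = 1 ∧ φ j = 0 ∧
    x = (1 / 2) * ∑ u : V, ∑ v : V, w s(u, v) * (φ u - φ v) ^ 2}

/-- Effective resistance between `i` and `j`. -/
def effRes (w : Sym2 V → ℝ) (i j : V) : ℝ := 1 / effCond w i j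

/-- Resistance distance between nodes `i` and `j` of a weighted line graph whose `k`-th edge
joins nodes `k` and `k+1` and has weight `wl k`. -/
def lineDist (wl : ℕ → ℝ) (i j : ℕ) : ℝ :=
  ∑ k ∈ Finset.Ico (min i j) (max i j), 1 / wl k

/-- φ-edges of a weighted line graph with `n` nodes `0, …, n-1`. -/
def linePhiSet (n : ℕ) (yl : ℕ → Bool) : Finset ℕ :=
  (Finset.range (n - 1)).filter (fun k => yl k ≠ yl (k + 1))

/-- Cutsize of a labeled line graph. -/
def linePhi (n : ℕ) (yl : ℕ → Bool) : ℕ := (linePhiSet n yl).card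

/-- Weighted cutsize of a labeled weighted line graph. -/
def linePhiW (n : ℕ) (wl : ℕ → ℝ) (yl : ℕ → Bool) : ℝ :=
  ∑ k ∈ linePhiSet n yl, wl k

/-- A run of the nearest-neighbor rule (the prediction phase of WTA) on a weighted line
graph with `n` nodes, weights `wl` and labels `yl`: an adversarial presentation order `σ`
together with predictions `pred`, where each prediction (after the first) is the label of a
closest previously revealed node in resistance distance. -/
structure NNRun (n : ℕ) (wl : ℕ → ℝ) (yl : ℕ → Bool) where
  σ : Fin n → Fin n
  bij : Function.Bijective σ
  pred : Fin n → Bool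
  nn : ∀ t : Fin n, 0 < (t : ℕ) →
    ∃ s : Fin n, (s : ℕ) < (t : ℕ) ∧
      (∀ s' : Fin n, (s' : ℕ) < (t : ℕ) →
        lineDist wl (σ s : ℕ) (σ t : ℕ) ≤ lineDist wl (σ s' : ℕ) (σ t : ℕ)) ∧
      pred t = yl (σ s : ℕ)

/-- Number of prediction mistakes of a nearest-neighbor run. -/
def NNRun.mistakes {n : ℕ} {wl : ℕ → ℝ} {yl : ℕ → Bool} (r : NNRun n wl yl) : ℕ :=
  (Finset.univ.filter (fun t : Fin n => r.pred t ≠ yl (r.σ t : ℕ))).card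

/-- Position of the first occurrence of `v` in the walk. -/
def firstOcc (walk : ℕ → V) (v : V) : ℕ := sInf {t | walk t = v}

/-- WTA's linearization of a tree `T` with `n` nodes: a depth-first visit of `T` is a closed
walk traversing each edge of `T` exactly twice; it produces the line graph with duplicates
`L'` (nodes `walk 0, …, walk (2(n-1))`, the `t`-th edge having weight `w s(walk t, walk (t+1))`).
Duplicate elimination yields the line graph `L` whose nodes are the nodes of `T` in order of
first visit (`ord`), consecutive nodes being joined by an edge whose weight is the minimum
weight among the eliminated edges of `L'` between them. -/
structure Linearization (T : SimpleGraph V) (n : ℕ) where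
  walk : ℕ → V
  adj : ∀ t < 2 * (n - 1), T.Adj (walk t) (walk (t + 1))
  closed : walk (2 * (n - 1)) = walk 0
  twice : ∀ e ∈ T.edgeSet,
    ((Finset.range (2 * (n - 1))).filter (fun t => s(walk t, walk (t + 1)) = e)).card = 2
  ord : ℕ → V
  ord_inj : ∀ k < n, ∀ k' < n, ord k = ord k' → k = k'
  ord_surj : ∀ v : V, ∃ k < n, ord k = v
  ord_mono : ∀ k k', k < k' → k' < n → firstOcc walk (ord k) < firstOcc walk (ord k')

/-- Edge weights of the line graph `L` produced by the linearization: the `k`-th edge of `L`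
joins the `k`-th and `(k+1)`-th nodes in order of first visit, and its weight is the minimum
of the weights of the edges of `L'` lying between the first occurrences of these two nodes
(the iterated duplicate-elimination rule `w_{j',j''} = min {w_{j',j}, w_{j,j''}}`). -/
def Linearization.wl {T : SimpleGraph V} {n : ℕ} (L : Linearization T n)
    (w : Sym2 V → ℝ) (k : ℕ) : ℝ :=
  sInf ((fun t => w s(L.walk t, L.walk (t + 1))) ''
    Set.Ico (firstOcc L.walk (L.ord k)) (firstOcc L.walk (L.ord (k + 1))))

/-- Labels of the line graph `L`: each node of `L` inherits the label of the corresponding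
node of `T`. -/
def Linearization.yl {T : SimpleGraph V} {n : ℕ} (L : Linearization T n)
    (y : V → Bool) (k : ℕ) : Bool := y (L.ord k)

/-- `ζ_T(K)`: the total weight of the `K` heaviest edges of `T`. -/
def zeta (T : SimpleGraph V) (w : Sym2 V → ℝ) (K : ℕ) : ℝ :=
  sSup {x | ∃ E' ⊆ T.edgeSet, E'.ncard = K ∧ x = ∑ᶠ e ∈ E', w e}

/-- `δ(y,y')`: number of nodes where the two labelings differ. -/
def hamming (y y' : V → Bool) : ℕ := {i | y i ≠ y' i}.ncard


/-- `Φ̃^W_T(y)`: robust weighted cutsize (minimum over perturbed labelings). -/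
def robustCutW (T : SimpleGraph V) (w : Sym2 V → ℝ) (y : V → Bool) : ℝ :=
  sInf {x | ∃ y' : V → Bool, x = 2 * (cutW T w y' + zeta T w (hamming y y'))}

/-- `Φ̃_T(y)`: robust cutsize (minimum over perturbed labelings). -/
def robustCutN (T : SimpleGraph V) (y : V → Bool) : ℝ :=
  sInf {x | ∃ y' : V → Bool, x = 2 * ((cutN T y' : ℝ) + (hamming y y' : ℝ))}

/-- `Φ*_G(y)`: robust expected cutsize of a random spanning tree of `G`. -/
def robustCutRST (G : SimpleGraph V) (w : Sym2 V → ℝ) (y : V → Bool) : ℝ :=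
  sInf {x | ∃ y' : V → Bool,
    x = rstExp G w (fun T => (cutN T y' : ℝ)) + (hamming y y' : ℝ)}

/-- Cutsize of the line graph with duplicates `L'`. -/
def Linearization.phi' {T : SimpleGraph V} {n : ℕ} (L : Linearization T n)
    (y : V → Bool) : ℕ :=
  ((Finset.range (2 * (n - 1))).filter (fun t => y (L.walk t) ≠ y (L.walk (t + 1)))).card

/-- Weighted cutsize of the line graph with duplicates `L'`. -/
def Linearization.phiW' {T : SimpleGraph V} {n : ℕ} (L : Linearization T n)
    (w : Sym2 V → ℝ) (y : V → Bool) : ℝ :=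
  ∑ t ∈ (Finset.range (2 * (n - 1))).filter (fun t => y (L.walk t) ≠ y (L.walk (t + 1))),
    w s(L.walk t, L.walk (t + 1))

/-- `p_e`: the probability that edge `e` belongs to a random spanning tree of `G`. -/
def edgeProb (G : SimpleGraph V) (w : Sym2 V → ℝ) (e : Sym2 V) : ℝ :=
  rstExp G w (fun T => if e ∈ T.edgeSet then 1 else 0)

/-- `p_{i,j} = w_{i,j} · r^W_{i,j}`. -/
def pWeight (w : Sym2 V → ℝ) (i j : V) : ℝ := w s(i, j) * effRes w i j

/-- `P_i = Σ_j p_{i,j}`: the weight of node `i`. -/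
def nodeWeight (G : SimpleGraph V) (w : Sym2 V → ℝ) (i : V) : ℝ :=
  ∑ j : V, if G.Adj i j then pWeight w i j else 0

/-- The `p`-weighted cutsize `Φ^P_G(y)`. -/
def pCutW (G : SimpleGraph V) (w : Sym2 V → ℝ) (y : V → Bool) : ℝ :=
  (1 / 2) * ∑ u : V, ∑ v : V, if G.Adj u v ∧ y u ≠ y v then pWeight w u v else 0

/-- `P^int_S`: sum of `p_{i,j}` over edges with both endpoints in `S`. -/
def pIntS (G : SimpleGraph V) (w : Sym2 V → ℝ) (S : Finset V) : ℝ :=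
  (1 / 2) * ∑ i ∈ S, ∑ j ∈ S, if G.Adj i j then pWeight w i j else 0

/-- `P^ext_S`: sum of `p_{i,j}` over edges with exactly one endpoint in `S`. -/
def pExtS (G : SimpleGraph V) (w : Sym2 V → ℝ) (S : Finset V) : ℝ :=
  ∑ i ∈ S, ∑ j ∈ Sᶜ, if G.Adj i j then pWeight w i j else 0

end

/-- A Boolean sequence taking different values at `a < b` changes somewhere in between. -/
theorem exists_ne_succ_of_ne {f : ℕ → Bool} {a b : ℕ} (hab : a < b) (h : f a ≠ f b) :
    ∃ t ∈ Set.Ico a b, f t ≠ f (t + 1) := by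
  by_contra! hc
  have key : ∀ m, a ≤ m → m ≤ b → f a = f m := by
    intro m hm
    induction m, hm using Nat.le_induction with
    | base => exact fun _ => rfl
    | succ m hm ih => exact fun hb => (ih (by omega)).trans (hc m ⟨hm, hb⟩)
  exact h (key b hab.le le_rfl)

namespace Linearization

variable {V : Type} [DecidableEq V] {T : SimpleGraph V} {n : ℕ}

theorem wl_le (L : Linearization T n) (w : Sym2 V → ℝ) {k t : ℕ}
    (ht : t ∈ Set.Ico (firstOcc L.walk (L.ord k)) (firstOcc L.walk (L.ord (k + 1)))) :
    L.wl w k ≤ w s(L.walk t, L.walk (t + 1)) :=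
  csInf_le ((Set.finite_Ico _ _).image _).bddBelow ⟨t, ht, rfl⟩

variable [Fintype V]

/-- The steps at which the depth-first walk traverses a φ-edge. -/
def cutSteps (L : Linearization T n) (y : V → Bool) : Finset ℕ :=
  (Finset.range (2 * (n - 1))).filter (fun t => y (L.walk t) ≠ y (L.walk (t + 1)))

theorem exists_walk_eq (hT : T.IsTree) (hn : n = Fintype.card V) (h2 : 2 ≤ n)
    (L : Linearization T n) (v : V) : ∃ t ≤ 2 * (n - 1), L.walk t = v := by
  have : Nontrivial V := Fintype.one_lt_card_iff_nontrivial.mp (by omega)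
  obtain ⟨u, hu⟩ := hT.connected.preconnected.exists_adj_of_nontrivial v
  have h := L.twice s(v, u) hu
  obtain ⟨t, ht⟩ := Finset.card_pos.mp (h ▸ Nat.two_pos)
  rw [Finset.mem_filter, Finset.mem_range, Sym2.eq_iff] at ht
  obtain ⟨ht, ⟨h, -⟩ | ⟨-, h⟩⟩ := ht
  · exact ⟨t, ht.le, h⟩
  · exact ⟨t + 1, ht, h⟩

theorem walk_firstOcc (hT : T.IsTree) (hn : n = Fintype.card V) (h2 : 2 ≤ n)
    (L : Linearization T n) (v : V) : L.walk (firstOcc L.walk v) = v := by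
  obtain ⟨t, -, h⟩ := L.exists_walk_eq hT hn h2 v
  exact Nat.sInf_mem (s := {t | L.walk t = v}) ⟨t, h⟩

theorem firstOcc_le (hT : T.IsTree) (hn : n = Fintype.card V) (h2 : 2 ≤ n)
    (L : Linearization T n) (v : V) : firstOcc L.walk v ≤ 2 * (n - 1) := by
  obtain ⟨t, ht, h⟩ := L.exists_walk_eq hT hn h2 v
  exact (Nat.sInf_le (s := {t | L.walk t = v}) h).trans ht

/-- Every φ-edge of `L` can be charged to a distinct φ-edge of `L'` among those it replaces. -/
theorem exists_injOn_cutSteps (hT : T.IsTree) (hn : n = Fintype.card V)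
    (L : Linearization T n) (y : V → Bool) :
    ∃ g : ℕ → ℕ, Set.InjOn g (linePhiSet n (L.yl y)) ∧
      ∀ k ∈ linePhiSet n (L.yl y), g k ∈ L.cutSteps y ∧
        g k ∈ Set.Ico (firstOcc L.walk (L.ord k)) (firstOcc L.walk (L.ord (k + 1))) := by
  have hex : ∀ k ∈ linePhiSet n (L.yl y), ∃ t, t ∈ L.cutSteps y ∧
      t ∈ Set.Ico (firstOcc L.walk (L.ord k)) (firstOcc L.walk (L.ord (k + 1))) := by
    intro k hk
    rw [linePhiSet, Finset.mem_filter, Finset.mem_range] at hk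
    obtain ⟨hk, hne⟩ := hk
    have h2 : 2 ≤ n := by omega
    obtain ⟨t, ht, hty⟩ := exists_ne_succ_of_ne (f := fun t => y (L.walk t))
      (L.ord_mono k (k + 1) (by omega) (by omega))
      (by simpa only [L.walk_firstOcc hT hn h2, yl] using hne)
    refine ⟨t, ?_, ht⟩
    rw [cutSteps, Finset.mem_filter, Finset.mem_range]
    exact ⟨ht.2.trans_le (L.firstOcc_le hT hn h2 _), hty⟩
  choose! g hg using hex
  have hlt : ∀ k ∈ linePhiSet n (L.yl y), ∀ k' ∈ linePhiSet n (L.yl y), k < k' → g k < g k' := by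
    intro k hk k' hk' hkk
    have hlast : k' < n - 1 := by
      rw [linePhiSet, Finset.mem_filter, Finset.mem_range] at hk'
      exact hk'.1
    have hmono : firstOcc L.walk (L.ord (k + 1)) ≤ firstOcc L.walk (L.ord k') := by
      rcases (Nat.succ_le_of_lt hkk).eq_or_lt with h | h
      · exact (congrArg (fun i => firstOcc L.walk (L.ord i)) h).le
      · exact (L.ord_mono _ _ h (by omega)).le
    exact (hg k hk).2.2.trans_le (hmono.trans (hg k' hk').2.1)
  refine ⟨g, fun k hk k' hk' h => ?_, hg⟩
  rcases lt_trichotomy k k' with hlt' | heq | hlt'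
  · exact absurd h (hlt k hk k' hk' hlt').ne
  · exact heq
  · exact absurd h (hlt k' hk' k hk hlt').ne'

/-- Each φ-edge of the tree is traversed exactly twice by the depth-first walk. -/
theorem sum_cutSteps (L : Linearization T n) (y : V → Bool) (w : Sym2 V → ℝ) :
    ∑ t ∈ L.cutSteps y, w s(L.walk t, L.walk (t + 1)) = 2 * cutW T w y := by
  have hfin : (phiEdges T y).Finite := Set.toFinite _
  rw [cutW, finsum_mem_eq_finite_toFinset_sum _ hfin, Finset.mul_sum,
    ← Finset.sum_fiberwise_of_maps_to (t := hfin.toFinset)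
      (g := fun t => s(L.walk t, L.walk (t + 1)))]
  · refine Finset.sum_congr rfl fun e he => ?_
    rw [Set.Finite.mem_toFinset] at he
    have hfilter : (L.cutSteps y).filter (fun t => s(L.walk t, L.walk (t + 1)) = e) =
        (Finset.range (2 * (n - 1))).filter (fun t => s(L.walk t, L.walk (t + 1)) = e) := by
      ext t
      simp only [cutSteps, Finset.mem_filter]
      refine ⟨fun h => ⟨h.1.1, h.2⟩, fun h => ⟨⟨h.1, ?_⟩, h.2⟩⟩
      have hphi := he.2
      rw [← h.2] at hphi
      exact hphi
    rw [Finset.sum_congr rfl fun t ht => congrArg w (Finset.mem_filter.mp ht).2,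
      Finset.sum_const, hfilter, L.twice e he.1, two_nsmul, two_mul]
  · intro t ht
    rw [cutSteps, Finset.mem_filter, Finset.mem_range] at ht
    rw [Set.Finite.mem_toFinset]
    exact ⟨L.adj t ht.1, ht.2⟩

theorem phiW'_eq (L : Linearization T n) (w : Sym2 V → ℝ) (y : V → Bool) :
    L.phiW' w y = 2 * cutW T w y := by
  rw [← L.sum_cutSteps]
  simp only [phiW', cutSteps]

theorem phi'_eq (L : Linearization T n) (y : V → Bool) : L.phi' y = 2 * cutN T y := by
  have h := L.sum_cutSteps y (fun _ => 1)
  rw [Finset.sum_const, nsmul_one, cutW, finsum_mem_eq_finite_toFinset_sum _ (Set.toFinite _),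
    Finset.sum_const, nsmul_one, ← Set.ncard_eq_toFinset_card] at h
  have h' : (L.cutSteps y).card = 2 * cutN T y := by exact_mod_cast h
  rw [← h']
  simp only [phi', cutSteps]

theorem linePhi_le_phi' (hT : T.IsTree) (hn : n = Fintype.card V)
    (L : Linearization T n) (y : V → Bool) : linePhi n (L.yl y) ≤ L.phi' y := by
  obtain ⟨g, hinj, hg⟩ := L.exists_injOn_cutSteps hT hn y
  have h := Finset.card_le_card_of_injOn g (fun k hk => (hg k hk).1) hinj
  simpa only [linePhi, phi', cutSteps] using h

theorem linePhiW_le_phiW' (hT : T.IsTree) (hn : n = Fintype.card V) {w : Sym2 V → ℝ}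
    (hw : ∀ e ∈ T.edgeSet, 0 ≤ w e) (L : Linearization T n) (y : V → Bool) :
    linePhiW n (L.wl w) (L.yl y) ≤ L.phiW' w y := by
  obtain ⟨g, hinj, hg⟩ := L.exists_injOn_cutSteps hT hn y
  calc linePhiW n (L.wl w) (L.yl y)
      ≤ ∑ k ∈ linePhiSet n (L.yl y), w s(L.walk (g k), L.walk (g k + 1)) :=
        Finset.sum_le_sum fun k hk => L.wl_le w (hg k hk).2
    _ = ∑ t ∈ (linePhiSet n (L.yl y)).image g, w s(L.walk t, L.walk (t + 1)) :=
        (Finset.sum_image (f := fun t => w s(L.walk t, L.walk (t + 1))) hinj).symm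
    _ ≤ ∑ t ∈ L.cutSteps y, w s(L.walk t, L.walk (t + 1)) := by
        refine Finset.sum_le_sum_of_subset_of_nonneg
          (Finset.image_subset_iff.mpr fun k hk => (hg k hk).1) fun t ht _ => ?_
        rw [cutSteps, Finset.mem_filter, Finset.mem_range] at ht
        exact hw _ (L.adj t ht.1)
    _ = L.phiW' w y := by simp only [phiW', cutSteps]

end Linearization

/-- Lemma 3. Let `(T,y)` be a labeled weighted tree, `L'` the line graph
with duplicates produced by WTA's depth-first linearization of `T`, and `L` the line graph
obtained after duplicate elimination, nodes inheriting the labels of `T`. Then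
(1) `Φ^W_L(y) ≤ Φ^W_{L'}(y) ≤ 2·Φ^W_T(y)` and (2) `Φ_L(y) ≤ Φ_{L'}(y) ≤ 2·Φ_T(y)`. -/
theorem cutsize_line_tree :
    ∀ (V : Type) [Fintype V] [DecidableEq V] (T : SimpleGraph V),
      T.IsTree →
      ∀ w : Sym2 V → ℝ, (∀ e ∈ T.edgeSet, 0 < w e) →
      ∀ (y : V → Bool) (n : ℕ), n = Fintype.card V →
      ∀ L : Linearization T n,
        (linePhiW n (L.wl w) (L.yl y) ≤ L.phiW' w y ∧
          L.phiW' w y ≤ 2 * cutW T w y) ∧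
        (linePhi n (L.yl y) ≤ L.phi' y ∧
          L.phi' y ≤ 2 * cutN T y) := by
  intro V _ _ T hT w hw y n hn L
  exact ⟨⟨L.linePhiW_le_phiW' hT hn (fun e he => (hw e he).le) y, (L.phiW'_eq w y).le⟩,
    L.linePhi_le_phi' hT hn y, (L.phi'_eq y).le⟩
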